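/- Let μ_1, μ_2 > 0, x > 0, and let N ≥ 1 and 1 ≤ ξ, η ≤ N be integers. Define f_{1(ξ)}(y) = [N!/((ξ−1)!(N−ξ)!)]·(1 − e^{−y/μ_1})^{ξ−1}·e^{−(N−ξ)y/μ_1}·(1/μ_1)e^{−y/μ_1} and F_{2(η)}(y) = ∑_{n=η}^{N} C(N,n)(1 − e^{−y/μ_2})^n (e^{−y/μ_2})^{N−n}. Then ∫_0^∞ (x/2)·log₂(1+s)·f_{1(ξ)}(x s)·F_{2(η)}(x s) ds = [N!/((2 ln 2)(ξ−1)!(N−ξ)!)] · ∑_{n=η}^{N} ∑_{d=0}^{n} ∑_{b=0}^{ξ−1} C(N,n) C(n,d) C(ξ−1,b)·(−1)^{b+d} · e^{x κ}·E₁(x κ)/(μ_1 κ), where κ = (N−ξ+1+b)/μ_1 + (N−n+d)/μ_2 and E₁(a) = ∫_a^∞ (e^{−u}/u) du. -/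

import Mathlib

/-- The exponential integral `E₁(a) = ∫_a^∞ e^{−u}/u du`. -/
noncomputable def E₁ (a : ℝ) : ℝ := ∫ u in Set.Ioi a, Real.exp (-u) / u

/-- The density of the `ξ`-th smallest order statistic of `N` i.i.d. exponentials with
mean `μ`. -/
noncomputable def fOrd (N ξ : ℕ) (μ y : ℝ) : ℝ :=
  ((N.factorial : ℝ) / ((ξ - 1).factorial * (N - ξ).factorial))
    * (1 - Real.exp (-y / μ)) ^ (ξ - 1) * Real.exp (-(N - ξ : ℕ) * y / μ)
    * ((1 / μ) * Real.exp (-y / μ))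

/-- The CDF of the `η`-th smallest order statistic of `N` i.i.d. exponentials with mean `μ`. -/
noncomputable def FOrd (N η : ℕ) (μ y : ℝ) : ℝ :=
  ∑ n ∈ Finset.Icc η N,
    (N.choose n : ℝ) * (1 - Real.exp (-y / μ)) ^ n * Real.exp (-y / μ) ^ (N - n)

open MeasureTheory Set Filter Topology

/-- The substitution `u = a (1 + s)` in the exponential integral. -/
lemma integral_exp_neg_mul_div_one_add {a : ℝ} (ha : 0 < a) :
    ∫ s in Ioi (0 : ℝ), Real.exp (-a * s) / (1 + s) = Real.exp a * E₁ a := by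
  have himg : (fun s : ℝ => a * (1 + s)) '' Ioi 0 = Ioi a := by
    ext u
    simp only [mem_image, mem_Ioi]
    constructor
    · rintro ⟨s, hs, rfl⟩
      nlinarith
    · intro hu
      refine ⟨u / a - 1, ?_, by field_simp; ring⟩
      rw [sub_pos, one_lt_div ha]
      exact hu
  have hsub := integral_image_eq_integral_abs_deriv_smul (f := fun s : ℝ => a * (1 + s))
    (f' := fun _ => a) (measurableSet_Ioi (a := (0 : ℝ)))
    (fun s _ => by
      simpa using (((hasDerivAt_id s).const_add 1).const_mul a).hasDerivWithinAt)
    (fun s _ t _ hst => by simpa [ha.ne'] using hst) (fun u => Real.exp (-u) / u)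
  rw [himg] at hsub
  rw [E₁, hsub, ← integral_const_mul]
  refine setIntegral_congr_fun measurableSet_Ioi fun s hs => ?_
  have hs' : (0 : ℝ) < 1 + s := by linarith [mem_Ioi.mp hs]
  have hexp : Real.exp (-a * s) = Real.exp a * Real.exp (-(a * (1 + s))) := by
    rw [← Real.exp_add]
    ring_nf
  simp only [smul_eq_mul, abs_of_pos ha, hexp]
  field_simp

lemma integrableOn_exp_neg_mul_div_one_add {a : ℝ} (ha : 0 < a) :
    IntegrableOn (fun s : ℝ => Real.exp (-a * s) / (1 + s)) (Ioi 0) := by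
  refine Integrable.mono' (integrableOn_exp_mul_Ioi (neg_lt_zero.mpr ha) 0)
    (Measurable.aestronglyMeasurable (by fun_prop)) ?_
  filter_upwards [ae_restrict_mem measurableSet_Ioi] with s hs
  have hs' : (0 : ℝ) < s := hs
  rw [Real.norm_of_nonneg (by positivity)]
  exact div_le_self (Real.exp_pos _).le (by linarith)

lemma integrableOn_log_one_add_mul_exp {a : ℝ} (ha : 0 < a) :
    IntegrableOn (fun s : ℝ => Real.log (1 + s) * Real.exp (-a * s)) (Ioi 0) := by
  refine Integrable.mono'
    ((integrableOn_exp_mul_Ioi (show -(a / 2) < 0 by linarith) 0).const_mul (2 / a))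
    (by fun_prop) ?_
  filter_upwards [ae_restrict_mem measurableSet_Ioi] with s hs
  have hs' : (0 : ℝ) < s := hs
  have hlog : Real.log (1 + s) ≤ s := by
    linarith [Real.log_le_sub_one_of_pos (show 0 < 1 + s by linarith)]
  have hlog0 : 0 ≤ Real.log (1 + s) := Real.log_nonneg (by linarith)
  have hexp : s ≤ 2 / a * Real.exp (a / 2 * s) := by
    have h := Real.add_one_le_exp (a / 2 * s)
    calc s = 2 / a * (a / 2 * s) := by field_simp
      _ ≤ _ := by gcongr; linarith
  rw [Real.norm_of_nonneg (by positivity)]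
  calc Real.log (1 + s) * Real.exp (-a * s)
      ≤ 2 / a * Real.exp (a / 2 * s) * Real.exp (-a * s) := by
        gcongr
        exact hlog.trans hexp
    _ = 2 / a * Real.exp (-(a / 2) * s) := by
        rw [mul_assoc, ← Real.exp_add]
        ring_nf

lemma tendsto_log_one_add_mul_exp {a : ℝ} (ha : 0 < a) :
    Tendsto (fun s : ℝ => Real.log (1 + s) * Real.exp (-a * s)) atTop (𝓝 0) := by
  have h := tendsto_rpow_mul_exp_neg_mul_atTop_nhds_zero 1 a ha
  refine tendsto_of_tendsto_of_tendsto_of_le_of_le' tendsto_const_nhds h ?_ ?_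
  · filter_upwards [eventually_gt_atTop 0] with s hs
    exact mul_nonneg (Real.log_nonneg (by linarith)) (Real.exp_pos _).le
  · filter_upwards [eventually_gt_atTop 0] with s hs
    rw [Real.rpow_one]
    gcongr
    linarith [Real.log_le_sub_one_of_pos (show 0 < 1 + s by linarith)]

/-- The Laplace transform of `log (1 + s)`. -/
lemma integral_log_one_add_mul_exp {a : ℝ} (ha : 0 < a) :
    ∫ s in Ioi (0 : ℝ), Real.log (1 + s) * Real.exp (-a * s) = Real.exp a * E₁ a / a := by
  have hderiv : ∀ s ∈ Ici (0 : ℝ),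
      HasDerivAt (fun s : ℝ => Real.log (1 + s) * Real.exp (-a * s))
        (Real.exp (-a * s) / (1 + s) - a * (Real.log (1 + s) * Real.exp (-a * s))) s := by
    intro s hs
    have hs' : (1 : ℝ) + s ≠ 0 := by linarith [mem_Ici.mp hs]
    have h1 : HasDerivAt (fun s : ℝ => Real.log (1 + s)) (1 / (1 + s)) s :=
      ((hasDerivAt_id s).const_add 1).log hs'
    have h2 : HasDerivAt (fun s : ℝ => Real.exp (-a * s)) (Real.exp (-a * s) * (-a * 1)) s :=
      ((hasDerivAt_id s).const_mul (-a)).exp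
    exact (h1.mul h2).congr_deriv (by ring)
  have hint1 := integrableOn_exp_neg_mul_div_one_add ha
  have hint2 := (integrableOn_log_one_add_mul_exp ha).const_mul a
  have h := integral_Ioi_of_hasDerivAt_of_tendsto' hderiv (hint1.sub hint2)
    (tendsto_log_one_add_mul_exp ha)
  rw [integral_sub hint1 hint2, integral_const_mul, integral_exp_neg_mul_div_one_add ha] at h
  simp only [add_zero, Real.log_one, zero_mul, sub_zero] at h
  rw [eq_div_iff ha.ne']
  linarith

lemma one_sub_pow_eq_sum (p : ℝ) (m : ℕ) :
    (1 - p) ^ m = ∑ b ∈ Finset.range (m + 1), (m.choose b : ℝ) * (-1) ^ b * p ^ b := by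
  rw [sub_eq_neg_add, add_pow]
  refine Finset.sum_congr rfl fun b _ => ?_
  rw [neg_pow, one_pow]
  ring

/-- The binomial expansion of the product of an order-statistic density and an
order-statistic CDF as a sum of exponentials. -/
lemma fOrd_mul_FOrd (N ξ η : ℕ) (hξ1 : 1 ≤ ξ) (hξN : ξ ≤ N) (μ₁ μ₂ y : ℝ) :
    fOrd N ξ μ₁ y * FOrd N η μ₂ y
      = ((N.factorial : ℝ) / ((ξ - 1).factorial * (N - ξ).factorial) / μ₁)
          * ∑ n ∈ Finset.Icc η N, ∑ d ∈ Finset.range (n + 1), ∑ b ∈ Finset.range ξ,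
              (N.choose n : ℝ) * (n.choose d : ℝ) * ((ξ - 1).choose b : ℝ) * (-1) ^ (b + d)
                * Real.exp (-((N - ξ + 1 + b) / μ₁ + (N - n + d) / μ₂) * y) := by
  have hsum1 := one_sub_pow_eq_sum (Real.exp (-y / μ₁)) (ξ - 1)
  rw [Nat.sub_add_cancel hξ1] at hsum1
  have hterm : ∀ n ∈ Finset.Icc η N, ∀ d b : ℕ,
      Real.exp (-((N - ξ + 1 + b) / μ₁ + (N - n + d) / μ₂) * y)
        = Real.exp (-(N - ξ : ℕ) * y / μ₁) * Real.exp (-y / μ₁) * Real.exp (-y / μ₁) ^ b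
          * (Real.exp (-y / μ₂) ^ d * Real.exp (-y / μ₂) ^ (N - n)) := by
    intro n hn d b
    simp only [← Real.exp_nat_mul, ← Real.exp_add]
    rw [Nat.cast_sub hξN, Nat.cast_sub (Finset.mem_Icc.mp hn).2]
    congr 1
    ring
  rw [FOrd, Finset.mul_sum, Finset.mul_sum]
  refine Finset.sum_congr rfl fun n hn => ?_
  simp only [fOrd, hsum1, one_sub_pow_eq_sum (Real.exp (-y / μ₂)), hterm n hn,
    Finset.mul_sum, Finset.sum_mul]
  refine Finset.sum_congr rfl fun d _ => Finset.sum_congr rfl fun b _ => ?_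
  ring

/-- Closed form for the cross term
`ν_{1,2}(ξ,η,x) = ∫_0^∞ (x/2)·log₂(1+s)·f_{1(ξ)}(xs)·F_{2(η)}(xs) ds` in the average
network capacity analysis. -/
theorem stmt_14 (μ₁ μ₂ x : ℝ) (hμ₁ : 0 < μ₁) (hμ₂ : 0 < μ₂) (hx : 0 < x)
    (N ξ η : ℕ) (hN : 1 ≤ N) (hξ1 : 1 ≤ ξ) (hξN : ξ ≤ N) (hη1 : 1 ≤ η) (hηN : η ≤ N) :
    ∫ s in Set.Ioi (0 : ℝ),
        (x / 2) * Real.logb 2 (1 + s) * fOrd N ξ μ₁ (x * s) * FOrd N η μ₂ (x * s)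
      = ((N.factorial : ℝ) / ((2 * Real.log 2) * (ξ - 1).factorial * (N - ξ).factorial))
          * ∑ n ∈ Finset.Icc η N, ∑ d ∈ Finset.range (n + 1), ∑ b ∈ Finset.range ξ,
              (N.choose n : ℝ) * (n.choose d : ℝ) * ((ξ - 1).choose b : ℝ) * (-1) ^ (b + d)
                * Real.exp (x * ((N - ξ + 1 + b) / μ₁ + (N - n + d) / μ₂))
                * E₁ (x * ((N - ξ + 1 + b) / μ₁ + (N - n + d) / μ₂))
                / (μ₁ * ((N - ξ + 1 + b) / μ₁ + (N - n + d) / μ₂)) := by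
  have hκ : ∀ n ∈ Finset.Icc η N, ∀ d b : ℕ,
      0 < ((N : ℝ) - ξ + 1 + b) / μ₁ + ((N : ℝ) - n + d) / μ₂ := by
    intro n hn d b
    have h1 : (ξ : ℝ) ≤ N := by exact_mod_cast hξN
    have h2 : (n : ℝ) ≤ N := by exact_mod_cast (Finset.mem_Icc.mp hn).2
    have h3 : 0 < (N : ℝ) - ξ + 1 + b := by
      have : (0 : ℝ) ≤ b := b.cast_nonneg
      linarith
    have h4 : 0 ≤ (N : ℝ) - n + d := by
      have : (0 : ℝ) ≤ d := d.cast_nonneg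
      linarith
    positivity
  have hpt : ∀ s : ℝ,
      (x / 2) * Real.logb 2 (1 + s) * fOrd N ξ μ₁ (x * s) * FOrd N η μ₂ (x * s)
        = ((N.factorial : ℝ) / ((2 * Real.log 2) * (ξ - 1).factorial * (N - ξ).factorial))
          * ∑ n ∈ Finset.Icc η N, ∑ d ∈ Finset.range (n + 1), ∑ b ∈ Finset.range ξ,
              x / μ₁ * ((N.choose n : ℝ) * (n.choose d : ℝ) * ((ξ - 1).choose b : ℝ)
                * (-1) ^ (b + d)) * (Real.log (1 + s)
                * Real.exp (-(x * ((N - ξ + 1 + b) / μ₁ + (N - n + d) / μ₂)) * s)) := by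
    intro s
    rw [mul_assoc, fOrd_mul_FOrd N ξ η hξ1 hξN, Real.logb]
    simp only [Finset.mul_sum]
    refine Finset.sum_congr rfl fun n _ => Finset.sum_congr rfl fun d _ =>
      Finset.sum_congr rfl fun b _ => ?_
    rw [show ∀ k : ℝ, -(x * k) * s = -k * (x * s) from fun k => by ring]
    ring
  have hint : ∀ n ∈ Finset.Icc η N, ∀ d b : ℕ, IntegrableOn (fun s : ℝ =>
      x / μ₁ * ((N.choose n : ℝ) * (n.choose d : ℝ) * ((ξ - 1).choose b : ℝ)
        * (-1) ^ (b + d)) * (Real.log (1 + s)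
        * Real.exp (-(x * ((N - ξ + 1 + b) / μ₁ + (N - n + d) / μ₂)) * s))) (Ioi 0) :=
    fun n hn d b =>
      (integrableOn_log_one_add_mul_exp (mul_pos hx (hκ n hn d b))).const_mul _
  simp only [hpt]
  rw [integral_const_mul, integral_finsetSum _ fun n hn => integrable_finsetSum _ fun d _ =>
    integrable_finsetSum _ fun b _ => hint n hn d b]
  congr 1
  refine Finset.sum_congr rfl fun n hn => ?_
  rw [integral_finsetSum _ fun d _ => integrable_finsetSum _ fun b _ => hint n hn d b]
  refine Finset.sum_congr rfl fun d _ => ?_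
  rw [integral_finsetSum _ fun b _ => hint n hn d b]
  refine Finset.sum_congr rfl fun b _ => ?_
  have hpos := hκ n hn d b
  rw [integral_const_mul, integral_log_one_add_mul_exp (mul_pos hx hpos)]
  generalize ((N : ℝ) - ξ + 1 + b) / μ₁ + ((N : ℝ) - n + d) / μ₂ = k at hpos ⊢
  field_simp
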